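/- arXiv:2511.10742 — 2 statements merged into one kernel-verified Lean document; each statement's English description precedes it below -/
import Mathlib

section
/- Let k be an algebraically closed field of characteristic 0, V a k-vector space of dimension d, and r an integer with 1 < r and 2r < d + 1. If A ⊆ End_k(V) is a commutative unital k-subalgebra that is r-spanning, then dim_k A ≤ r·(d − r) + 1. -/
/-- A set `A` of endomorphisms of `V` is `r`-spanning if there exists a subspace `U ⊆ V`
with `dim U ≤ r` such that `V` is spanned by `{f u : f ∈ A, u ∈ U}`. -/
def IsRSpanning (k : Type*) {V : Type*} [Field k] [AddCommGroup V] [Module k V]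
    (A : Set (Module.End k V)) (r : ℕ) : Prop :=
  ∃ U : Submodule k V, Module.finrank k U ≤ r ∧
    Submodule.span k {w : V | ∃ f ∈ A, ∃ u ∈ U, w = f u} = ⊤

lemma nakayama_aux {R V : Type*} [CommRing R] [AddCommGroup V] [Module R V]
    (I : Ideal R) (n : ℕ) (hI : I ^ n ≤ Module.annihilator R V) (K : Submodule R V)
    (hK : K ⊔ I • (⊤ : Submodule R V) = ⊤) : K = ⊤ := by
  have key : ∀ m : ℕ, K ⊔ I ^ m • (⊤ : Submodule R V) = ⊤ := by
    intro m
    induction m with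
    | zero => simp
    | succ m ih =>
      have h1 : I ^ m • (⊤ : Submodule R V) ≤ K ⊔ I ^ (m + 1) • (⊤ : Submodule R V) := by
        conv_lhs => rw [← hK]
        rw [Submodule.smul_sup, pow_succ, Submodule.mul_smul]
        exact sup_le_sup_right Submodule.smul_le_right _
      rw [eq_top_iff]
      conv_lhs => rw [← ih]
      exact sup_le le_sup_left h1
  have h2 : I ^ n • (⊤ : Submodule R V) = ⊥ := by
    rw [eq_bot_iff, Submodule.smul_le]
    intro x hx v _
    have := Module.mem_annihilator.1 (hI hx) v
    simp [this]
  simpa [h2] using key n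

lemma local_case {k R V : Type*} [Field k] [CommRing R] [Algebra k R] [Module.Finite k R]
    [AddCommGroup V] [Module k V] [Module R V] [IsScalarTower k R V] [Module.Finite k V]
    [Nontrivial V] (r : ℕ) (U : Submodule k V) (hU : Module.finrank k U ≤ r)
    (hspan : Submodule.span R (U : Set V) = ⊤)
    (hloc : ∀ x : R, ∃ c : k, x - algebraMap k R c ∈ (Module.annihilator R V).radical) :
    ∃ s t : ℕ, 1 ≤ s ∧ s ≤ r ∧ s + t = Module.finrank k V ∧
      Module.finrank k R ≤
        Module.finrank k ((Module.annihilator R V).restrictScalars k) + s * t + 1 := by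
  set a := Module.annihilator R V with ha
  set I := a.radical with hI
  have : IsNoetherianRing R := IsNoetherianRing.of_finite k R
  obtain ⟨n, hn⟩ := Ideal.exists_radical_pow_le_of_fg a (IsNoetherian.noetherian _)
  set W : Submodule R V := I • ⊤ with hW
  set Wk : Submodule k V := W.restrictScalars k with hWk
  obtain ⟨C, hC⟩ := Wk.exists_isCompl
  have hdim := Submodule.finrank_add_eq_of_isCompl hC.symm
  refine ⟨Module.finrank k C, Module.finrank k Wk, ?_, ?_, hdim, ?_⟩
  · by_contra h
    have h0 : C = ⊥ := Submodule.finrank_eq_zero.1 (by omega)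
    have h1 : Wk = ⊤ := by
      have := hC.sup_eq_top
      simpa [h0] using this
    have h2 : W = ⊤ := by
      ext v
      have : v ∈ Wk ↔ v ∈ (⊤ : Submodule k V) := by rw [h1]
      simpa [hWk] using this
    have h3 := nakayama_aux I n hn (⊥ : Submodule R V) (by simpa using h2)
    exact bot_ne_top h3
  · have hUW : U ⊔ Wk = ⊤ := by
      rw [eq_top_iff]
      intro v _
      have hv : v ∈ Submodule.span R (U : Set V) := by rw [hspan]; trivial
      induction hv using Submodule.span_induction with
      | mem x hx => exact Submodule.mem_sup_left hx
      | zero => exact Submodule.zero_mem _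
      | add x y _ _ hx hy => exact Submodule.add_mem _ (hx trivial) (hy trivial)
      | smul x v _ hv =>
        obtain ⟨c, hc⟩ := hloc x
        have e : x • v = (x - algebraMap k R c) • v + c • v := by
          rw [sub_smul, algebraMap_smul]; abel
        rw [e]
        refine Submodule.add_mem _ (Submodule.mem_sup_right ?_) (Submodule.smul_mem _ _ (hv trivial))
        have hm : (x - algebraMap k R c) • v ∈ W := Submodule.smul_mem_smul hc Submodule.mem_top
        exact hm
    have h1 := Submodule.finrank_add_le_finrank_add_finrank U Wk
    rw [hUW, finrank_top] at h1
    omega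
  · -- the map I → Hom(C, W)
    have hmem : ∀ x ∈ I, ∀ v : V, x • v ∈ W := fun x hx v =>
      Submodule.smul_mem_smul hx Submodule.mem_top
    let Ik : Submodule k R := I.restrictScalars k
    let Φ : Ik →ₗ[k] (C →ₗ[k] Wk) :=
      LinearMap.mk₂ k (fun x v => ⟨(x : R) • (v : V), hmem x x.2 v⟩)
        (by intro x y v; ext; simp [add_smul])
        (by intro c x v; ext; simp)
        (by intro x v w; ext; simp)
        (by intro c x v; ext; exact smul_comm (x : R) c (v : V))
    have hker : Module.finrank k (LinearMap.ker Φ) ≤ Module.finrank k (a.restrictScalars k) := by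
      rw [← LinearMap.finrank_range_of_inj (f := Ik.subtype ∘ₗ (LinearMap.ker Φ).subtype)
        (Subtype.val_injective.comp Subtype.val_injective)]
      apply Submodule.finrank_mono
      rintro _ ⟨⟨x, hx⟩, rfl⟩
      simp only [LinearMap.coe_comp, Submodule.coe_subtype, Function.comp_apply]
      show (x : R) ∈ a
      have hx0 : ∀ v ∈ C, (x : R) • v = 0 := by
        intro v hv
        have := LinearMap.congr_fun (LinearMap.mem_ker.1 hx) ⟨v, hv⟩
        exact congrArg Subtype.val this
      let K : Submodule R V := LinearMap.ker (LinearMap.lsmul R V (x : R))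
      have hK : K = ⊤ := by
        apply nakayama_aux I n hn
        rw [eq_top_iff]
        intro v _
        have hv : v ∈ Wk ⊔ C := by rw [hC.sup_eq_top]; trivial
        obtain ⟨w, hw, c, hc, rfl⟩ := Submodule.mem_sup.1 hv
        refine Submodule.add_mem _ (Submodule.mem_sup_right hw) (Submodule.mem_sup_left ?_)
        exact hx0 c hc
      rw [ha, Module.mem_annihilator]
      intro v
      have : v ∈ K := by rw [hK]; trivial
      exact this
    have hrn := LinearMap.finrank_range_add_finrank_ker Φ
    have hr := Submodule.finrank_le (LinearMap.range Φ)
    rw [Module.finrank_linearMap] at hr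
    have hRI : Module.finrank k R ≤ Module.finrank k Ik + 1 := by
      have hsup : Ik ⊔ Submodule.span k {(1 : R)} = ⊤ := by
        rw [eq_top_iff]
        intro x _
        obtain ⟨c, hc⟩ := hloc x
        have e : x = (x - algebraMap k R c) + c • (1 : R) := by
          rw [Algebra.algebraMap_eq_smul_one]; abel
        rw [e]
        exact Submodule.add_mem _ (Submodule.mem_sup_left hc)
          (Submodule.mem_sup_right (Submodule.smul_mem _ _ (Submodule.mem_span_singleton_self _)))
      have h1 := Submodule.finrank_add_le_finrank_add_finrank Ik (Submodule.span k {(1 : R)})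
      rw [hsup, finrank_top] at h1
      have h2 := finrank_span_le_card (R := k) ({(1 : R)} : Set R)
      simp at h2
      omega
    omega

lemma comb_aux {s t s' t' r : ℕ} (h1 : 1 ≤ s) (hs : s ≤ r) (h1' : 1 ≤ s') (hs' : s' ≤ r)
    (d : ℕ) (hd : s + t + (s' + t') = d) :
    ∃ p q : ℕ, 1 ≤ p ∧ p ≤ r ∧ p + q = d ∧ (s * t + 1) + (s' * t' + 1) ≤ p * q + 1 := by
  rcases le_total s' s with h | h
  · refine ⟨s, t + t' + s', h1, hs, by omega, ?_⟩
    have := Nat.mul_le_mul_right t' h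
    have := Nat.mul_le_mul h1 h1'
    nlinarith
  · refine ⟨s', t + t' + s, h1', hs', by omega, ?_⟩
    have := Nat.mul_le_mul_right t h
    have := Nat.mul_le_mul h1 h1'
    nlinarith

universe u v w

lemma gen_case {k : Type u} {R : Type v} [Field k] [IsAlgClosed k] [CommRing R] [Algebra k R]
    [Module.Finite k R] (r : ℕ) (n : ℕ) : ∀ (V : Type w)
    [AddCommGroup V] [Module k V] [Module R V] [IsScalarTower k R V] [Module.Finite k V]
    [Nontrivial V] (U : Submodule k V) (_ : Module.finrank k V = n) (_ : Module.finrank k U ≤ r)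
    (_ : Submodule.span R (U : Set V) = ⊤),
    ∃ s t : ℕ, 1 ≤ s ∧ s ≤ r ∧ s + t = Module.finrank k V ∧
      Module.finrank k R ≤
        Module.finrank k ((Module.annihilator R V).restrictScalars k) + s * t + 1 := by
  induction n using Nat.strong_induction_on with
  | _ n ih =>
  intro V _ _ _ _ _ _ U hn hU hspan
  by_cases hloc : ∀ x : R, ∃ c : k, x - algebraMap k R c ∈ (Module.annihilator R V).radical
  · exact local_case r U hU hspan hloc
  push Not at hloc
  obtain ⟨x, hx⟩ := hloc
  obtain ⟨c, hc⟩ := Module.End.exists_eigenvalue (Algebra.lsmul k k V x)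
  obtain ⟨v, hv⟩ := hc.exists_hasEigenvector
  have hxv : (x - algebraMap k R c) • v = 0 := by
    have := hv.apply_eq_smul
    rw [sub_smul, algebraMap_smul, sub_eq_zero]
    simpa using this
  have hv0 : v ≠ 0 := hv.2
  have hy := hx c
  generalize x - algebraMap k R c = y at hy hxv
  let φ : V →ₗ[R] V := LinearMap.lsmul R V y
  have hφ : ∀ m (w : V), (φ ^ m) w = y ^ m • w := by
    intro m
    induction m with
    | zero => simp
    | succ m ihm => intro w; rw [pow_succ, pow_succ, Module.End.mul_apply, ihm, mul_smul]; rfl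
  have : IsNoetherian R V := isNoetherian_of_tower k inferInstance
  have : IsArtinian R V := isArtinian_of_tower k inferInstance
  obtain ⟨m, hm, hm1⟩ := ((LinearMap.eventually_isCompl_ker_pow_range_pow φ).and
    (Filter.eventually_ge_atTop 1)).exists
  generalize hPdef : LinearMap.ker (φ ^ m) = P at hm
  generalize hQdef : LinearMap.range (φ ^ m) = Q at hm
  have hP0 : P ≠ ⊥ := by
    rintro rfl
    have : v ∈ LinearMap.ker (φ ^ m) := by
      rw [LinearMap.mem_ker, hφ]
      obtain ⟨j, rfl⟩ : ∃ j, m = j + 1 := ⟨m - 1, by omega⟩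
      rw [pow_succ, mul_smul, hxv, smul_zero]
    rw [hPdef] at this
    exact hv0 (by simpa using this)
  have hQ0 : Q ≠ ⊥ := by
    rintro rfl
    apply hy
    refine ⟨m, Module.mem_annihilator.2 fun w => ?_⟩
    have : (φ ^ m) w ∈ LinearMap.range (φ ^ m) := ⟨w, rfl⟩
    rw [hQdef] at this
    rw [← hφ]; simpa using this
  have hadd : Module.finrank k P + Module.finrank k Q = Module.finrank k V := by
    have e := ((Submodule.prodEquivOfIsCompl P Q hm).restrictScalars k).finrank_eq
    have : Module.Finite k P := inferInstanceAs (Module.Finite k (P.restrictScalars k))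
    have : Module.Finite k Q := inferInstanceAs (Module.Finite k (Q.restrictScalars k))
    rw [← e, Module.finrank_prod]
  have step : ∀ P Q : Submodule R V, IsCompl P Q → P ≠ ⊥ → Module.finrank k P < n →
      ∃ s t : ℕ, 1 ≤ s ∧ s ≤ r ∧ s + t = Module.finrank k P ∧
      Module.finrank k R ≤
        Module.finrank k ((Module.annihilator R P).restrictScalars k) + s * t + 1 := by
    intro P Q hPQ hP hlt
    have : Module.Finite k P := inferInstanceAs (Module.Finite k (P.restrictScalars k))
    have : Nontrivial P := (Submodule.nontrivial_iff_ne_bot).2 hP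
    let π : V →ₗ[R] P := Submodule.projectionOnto P Q hPQ
    refine ih _ hlt P (U.map (π.restrictScalars k)) rfl
      ((Submodule.finrank_map_le _ _).trans hU) ?_
    have h1 : ((U.map (π.restrictScalars k) : Submodule k P) : Set P) = π '' (U : Set V) := by
      ext; simp
    rw [h1, Submodule.span_image, hspan, Submodule.map_top]
    exact Submodule.range_projectionOnto hPQ
  have posP : 0 < Module.finrank k P := by
    have : Module.Finite k P := inferInstanceAs (Module.Finite k (P.restrictScalars k))
    have : Nontrivial P := (Submodule.nontrivial_iff_ne_bot).2 hP0
    exact Module.finrank_pos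
  have posQ : 0 < Module.finrank k Q := by
    have : Module.Finite k Q := inferInstanceAs (Module.Finite k (Q.restrictScalars k))
    have : Nontrivial Q := (Submodule.nontrivial_iff_ne_bot).2 hQ0
    exact Module.finrank_pos
  obtain ⟨s, t, h1, h2, h3, h4⟩ := step P Q hm hP0 (by omega)
  obtain ⟨s', t', h1', h2', h3', h4'⟩ := step Q P hm.symm hQ0 (by omega)
  obtain ⟨p, q, g1, g2, g3, g4⟩ := comb_aux (t := t) (t' := t') h1 h2 h1' h2' (Module.finrank k V) (by omega)
  refine ⟨p, q, g1, g2, g3, ?_⟩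
  have hinf : (Module.annihilator R P).restrictScalars k ⊓ (Module.annihilator R Q).restrictScalars k
      ≤ (Module.annihilator R V).restrictScalars k := by
    rintro z ⟨hz1, hz2⟩
    have hz1 : z ∈ Module.annihilator R P := hz1
    have hz2 : z ∈ Module.annihilator R Q := hz2
    show z ∈ Module.annihilator R V
    rw [Module.mem_annihilator] at *
    intro w
    have hw : w ∈ P ⊔ Q := by rw [hm.sup_eq_top]; trivial
    obtain ⟨a, ha, b, hb, rfl⟩ := Submodule.mem_sup.1 hw
    have e1 := congrArg Subtype.val (hz1 ⟨a, ha⟩)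
    have e2 := congrArg Subtype.val (hz2 ⟨b, hb⟩)
    simp at e1 e2
    rw [smul_add, e1, e2, add_zero]
  have f1 := Submodule.finrank_mono hinf
  have f2 := Submodule.finrank_sup_add_finrank_inf_eq ((Module.annihilator R P).restrictScalars k)
    ((Module.annihilator R Q).restrictScalars k)
  have f3 := Submodule.finrank_le ((Module.annihilator R P).restrictScalars k ⊔
    (Module.annihilator R Q).restrictScalars k)
  omega

theorem dim_le_of_commutative_rSpanning
    {k V : Type*} [Field k] [IsAlgClosed k] [CharZero k]
    [AddCommGroup V] [Module k V] [FiniteDimensional k V]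
    (d r : ℕ) (hd : Module.finrank k V = d) (hr1 : 1 < r) (hr2 : 2 * r < d + 1)
    (A : Subalgebra k (Module.End k V))
    (hcomm : ∀ f ∈ A, ∀ g ∈ A, f * g = g * f)
    (hspan : IsRSpanning k (A : Set (Module.End k V)) r) :
    Module.finrank k A ≤ r * (d - r) + 1 := by
  obtain ⟨U, hU, hsp⟩ := hspan
  letI : CommRing A := { (inferInstance : Ring A) with
    mul_comm := fun a b => Subtype.ext (hcomm a a.2 b b.2) }
  have : Nontrivial V := Module.nontrivial_of_finrank_pos (R := k) (by omega)
  have hfin : Module.Finite k A :=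
    inferInstanceAs (Module.Finite k (Subalgebra.toSubmodule A))
  have hs : Submodule.span A (U : Set V) = ⊤ := by
    have h : (⊤ : Submodule k V) ≤ (Submodule.span A (U : Set V)).restrictScalars k := by
      rw [← hsp, Submodule.span_le]
      rintro _ ⟨f, hf, u, hu, rfl⟩
      exact Submodule.smul_mem _ (⟨f, hf⟩ : A) (Submodule.subset_span hu)
    rw [eq_top_iff]
    intro v _
    exact h (Submodule.mem_top (x := v))
  obtain ⟨s, t, h1, h2, h3, h4⟩ := gen_case (k := k) (R := A) r d V U hd hU hs
  have hann : (Module.annihilator A V).restrictScalars k = ⊥ := by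
    rw [eq_bot_iff]
    intro x hx
    have hx : x ∈ Module.annihilator A V := hx
    rw [Module.mem_annihilator] at hx
    rw [Submodule.mem_bot]
    exact Subtype.ext (LinearMap.ext hx)
  rw [hann, finrank_bot] at h4
  have h5 : s * t ≤ r * (d - r) := by
    obtain ⟨i, rfl⟩ := Nat.exists_eq_add_of_le h2
    obtain ⟨j, rfl⟩ : ∃ j, d = 2 * (s + i) + j := Nat.exists_eq_add_of_le (by omega)
    have ht : t = s + 2 * i + j := by omega
    have hdr : 2 * (s + i) + j - (s + i) = s + i + j := by omega
    rw [hdr, ht]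
    nlinarith [Nat.zero_le (i * i), Nat.zero_le (i * j)]
  omega
end

section
/- Let k be an algebraically closed field of characteristic 0, n ≥ 2 and r ≥ 1 integers, and S = k[x₁,…,xₙ] the polynomial ring. Let M be an S-module with dim_k M = 2, let φ: S^{⊕r} → M be a surjective S-module homomorphism, and let K = ker φ. If at least one variable xᵢ acts on M by a non-scalar k-endomorphism, then dim_k Hom_S(K, M) = 2n + 2r − 2; if every xᵢ acts on M by multiplication by a scalar in k, then dim_k Hom_S(K, M) > 2n + 2r − 2. -/
open MvPolynomial

section HomKerAux

variable {k : Type*} [Field k] {n r : ℕ}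
    {M : Type*} [AddCommGroup M] [Module k M]
    [Module (MvPolynomial (Fin n) k) M]
    [IsScalarTower k (MvPolynomial (Fin n) k) M]

/-- Commuting families define algebra homomorphisms out of a polynomial ring. -/
lemma exists_aeval_of_commute {A : Type*} [Ring A] [Algebra k A] (a : Fin n → A)
    (ha : ∀ i j, a i * a j = a j * a i) :
    ∃ ρ : MvPolynomial (Fin n) k →ₐ[k] A, ∀ i, ρ (X i) = a i := by
  letI : CommRing (Algebra.adjoin k (Set.range a)) :=
    Algebra.adjoinCommRingOfComm k (by
      rintro _ ⟨i, rfl⟩ _ ⟨j, rfl⟩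
      exact ha i j)
  let b : Fin n → Algebra.adjoin k (Set.range a) :=
    fun i => ⟨a i, Algebra.subset_adjoin ⟨i, rfl⟩⟩
  refine ⟨(Algebra.adjoin k (Set.range a)).val.comp (aeval b), fun i => ?_⟩
  rw [AlgHom.comp_apply, aeval_X]
  rfl

/-- The action of a variable. -/
noncomputable def actX (k : Type*) [Field k] {n : ℕ} (M : Type*) [AddCommGroup M] [Module k M]
    [Module (MvPolynomial (Fin n) k) M]
    [IsScalarTower k (MvPolynomial (Fin n) k) M] (i : Fin n) : M →ₗ[k] M :=
  Algebra.lsmul k k M (X i : MvPolynomial (Fin n) k)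

lemma actX_apply (i : Fin n) (m : M) :
    actX k M i m = (X i : MvPolynomial (Fin n) k) • m := rfl

lemma actX_comm (i j : Fin n) (m : M) :
    actX k M i (actX k M j m) = actX k M j (actX k M i m) := by
  simp only [actX_apply, smul_smul, mul_comm]

lemma map_smul_of_X {N : Type*} [AddCommGroup N] [Module k N]
    [Module (MvPolynomial (Fin n) k) N] [IsScalarTower k (MvPolynomial (Fin n) k) N]
    (g : N →ₗ[k] M)
    (hg : ∀ (i : Fin n) (f : N), g ((X i : MvPolynomial (Fin n) k) • f)
      = (X i : MvPolynomial (Fin n) k) • g f)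
    (p : MvPolynomial (Fin n) k) (f : N) : g (p • f) = p • g f := by
  induction p using MvPolynomial.induction_on generalizing f with
  | C a =>
    rw [← MvPolynomial.algebraMap_eq, algebraMap_smul, algebraMap_smul, map_smul]
  | add p q hp hq => rw [add_smul, add_smul, map_add, hp, hq]
  | mul_X p i hp => rw [mul_smul, mul_smul, hp, hg]

/-- First-order deformations of the commuting tuple. -/
def defZ (k : Type*) [Field k] {n : ℕ} (M : Type*) [AddCommGroup M] [Module k M]
    [Module (MvPolynomial (Fin n) k) M]
    [IsScalarTower k (MvPolynomial (Fin n) k) M] : Submodule k (Fin n → (M →ₗ[k] M)) where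
  carrier := {D | ∀ i j (m : M), actX k M i (D j m) + D i (actX k M j m)
    = actX k M j (D i m) + D j (actX k M i m)}
  zero_mem' := by intro i j m; simp
  add_mem' := by
    intro D E hD hE i j m
    have h1 := hD i j m
    have h2 := hE i j m
    simp only [Pi.add_apply, LinearMap.add_apply, map_add]
    calc _ = (actX k M i (D j m) + D i (actX k M j m))
          + (actX k M i (E j m) + E i (actX k M j m)) := by abel
      _ = _ := by rw [h1, h2]; abel
  smul_mem' := by
    intro c D hD i j m
    have h1 := hD i j m
    simp only [Pi.smul_apply, LinearMap.smul_apply, map_smul, ← smul_add, h1]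

lemma exists_psi (φ : (Fin r → MvPolynomial (Fin n) k) →ₗ[MvPolynomial (Fin n) k] M)
    (D : Fin n → (M →ₗ[k] M)) (hD : D ∈ defZ k M) (v : Fin r → M) :
    ∃ ψ : (Fin r → MvPolynomial (Fin n) k) →ₗ[k] M,
      (∀ i f, ψ ((X i : MvPolynomial (Fin n) k) • f)
        = (X i : MvPolynomial (Fin n) k) • ψ f + D i (φ f)) ∧
      ∀ j, ψ (Pi.single j 1) = v j := by
  let a : Fin n → Module.End k (M × M) := fun i =>
    LinearMap.prod (actX k M i ∘ₗ LinearMap.fst k M M)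
      (actX k M i ∘ₗ LinearMap.snd k M M + D i ∘ₗ LinearMap.fst k M M)
  have ha1 : ∀ i (z : M × M), a i z = (actX k M i z.1, actX k M i z.2 + D i z.1) :=
    fun i z => rfl
  obtain ⟨ρ, hρ⟩ := exists_aeval_of_commute (k := k) a (by
    intro i j
    apply LinearMap.ext
    intro z
    rw [Module.End.mul_apply, Module.End.mul_apply, ha1, ha1, ha1, ha1]
    refine Prod.ext (actX_comm i j _) ?_
    have := hD i j z.1
    simp only [map_add, add_assoc, this, actX_comm i j z.2])
  have hfst : ∀ (p : MvPolynomial (Fin n) k) (z : M × M), (ρ p z).1 = p • z.1 := by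
    intro p
    induction p using MvPolynomial.induction_on with
    | C a =>
      intro z
      rw [← MvPolynomial.algebraMap_eq, AlgHom.commutes, algebraMap_smul]; rfl
    | add p q hp hq => intro z; rw [map_add, add_smul, LinearMap.add_apply, Prod.fst_add, hp, hq]
    | mul_X p i hp =>
      intro z
      rw [map_mul, Module.End.mul_apply, hp, hρ, ha1, mul_smul, actX_apply]
  let L : (Fin r → MvPolynomial (Fin n) k) →ₗ[k] M × M :=
    ∑ j, (LinearMap.applyₗ (φ (Pi.single j 1), v j) ∘ₗ ρ.toLinearMap) ∘ₗ LinearMap.proj j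
  have hL : ∀ f, L f = ∑ j, ρ (f j) (φ (Pi.single j 1), v j) := by
    intro f; simp [L]
  have hL1 : ∀ f, (L f).1 = φ f := by
    intro f
    rw [hL, Prod.fst_sum]
    simp only [hfst]
    conv_rhs => rw [pi_eq_sum_univ' f]
    simp only [map_sum, map_smul]
  have hLX : ∀ i f, L ((X i : MvPolynomial (Fin n) k) • f) = a i (L f) := by
    intro i f
    rw [hL, hL, map_sum]
    refine Finset.sum_congr rfl fun j _ => ?_
    rw [Pi.smul_apply, smul_eq_mul, map_mul, Module.End.mul_apply, hρ]
  refine ⟨LinearMap.snd k M M ∘ₗ L, fun i f => ?_, fun j => ?_⟩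
  · rw [LinearMap.comp_apply, hLX, ha1, hL1]; rfl
  · rw [LinearMap.comp_apply, hL, Finset.sum_eq_single j]
    · simp
    · intro b _ hb; simp [Pi.single_eq_of_ne hb]
    · simp

lemma pi_psi_zero (g : (Fin r → MvPolynomial (Fin n) k) →ₗ[k] M)
    (hg : ∀ (i : Fin n) (f : Fin r → MvPolynomial (Fin n) k),
      g ((X i : MvPolynomial (Fin n) k) • f) = (X i : MvPolynomial (Fin n) k) • g f)
    (h0 : ∀ j, g (Pi.single j 1) = 0) : g = 0 := by
  apply LinearMap.ext
  intro f
  rw [pi_eq_sum_univ' f, map_sum]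
  simp only [map_smul_of_X g hg, h0, smul_zero, Finset.sum_const_zero, LinearMap.zero_apply]

lemma hom_ker_equiv (φ : (Fin r → MvPolynomial (Fin n) k) →ₗ[MvPolynomial (Fin n) k] M)
    (hφ : Function.Surjective φ) :
    Nonempty (((↥(LinearMap.ker φ) →ₗ[MvPolynomial (Fin n) k] M) × (M →ₗ[k] M)) ≃ₗ[k]
      (defZ (n := n) k M) × (Fin r → M)) := by
  obtain ⟨s, hs⟩ := (φ.restrictScalars k).exists_rightInverse_of_surjective
    (LinearMap.range_eq_top.mpr hφ)
  have hs' : ∀ m, φ (s m) = m := fun m => LinearMap.congr_fun hs m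
  let π : (Fin r → MvPolynomial (Fin n) k) →ₗ[k] LinearMap.ker φ :=
    { toFun := fun f => ⟨f - s (φ f), by simp [hs']⟩
      map_add' := by
        intro f g; ext1; simp; abel
      map_smul' := by
        intro c f; ext1
        have : φ (c • f) = c • φ f := (φ.restrictScalars k).map_smul c f
        simp [this, smul_sub] }
  have hπ : ∀ f, ((π f : LinearMap.ker φ) : Fin r → MvPolynomial (Fin n) k) = f - s (φ f) :=
    fun f => rfl
  have hπK : ∀ f : LinearMap.ker φ, π f = f := by
    intro f; ext1; rw [hπ, LinearMap.mem_ker.mp f.2]; simp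
  have hπs : ∀ m, π (s m) = 0 := by
    intro m; ext1; rw [hπ, hs']; simp
  have hdec : ∀ f, f = (π f : Fin r → MvPolynomial (Fin n) k) + s (φ f) := by
    intro f; rw [hπ]; abel
  -- the extension of a pair
  let E : ((↥(LinearMap.ker φ) →ₗ[MvPolynomial (Fin n) k] M) × (M →ₗ[k] M)) →ₗ[k]
      ((Fin r → MvPolynomial (Fin n) k) →ₗ[k] M) :=
    { toFun := fun q => (q.1.restrictScalars k) ∘ₗ π + q.2 ∘ₗ (φ.restrictScalars k)
      map_add' := by intro p q; apply LinearMap.ext; intro f; simp; abel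
      map_smul' := by intro c q; apply LinearMap.ext; intro f; simp }
  have hE : ∀ q f, E q f = q.1 (π f) + q.2 (φ f) := fun q f => rfl
  have hEK : ∀ q (f : LinearMap.ker φ), E q f = q.1 f := by
    intro q f; rw [hE, hπK, LinearMap.mem_ker.mp f.2]; simp
  have hEs : ∀ q m, E q (s m) = q.2 m := by
    intro q m; rw [hE, hπs, hs']; simp
  let Dm : ((↥(LinearMap.ker φ) →ₗ[MvPolynomial (Fin n) k] M) × (M →ₗ[k] M)) →ₗ[k]
      (Fin n → (M →ₗ[k] M)) :=
    { toFun := fun q i => (E q) ∘ₗ (actX k (Fin r → MvPolynomial (Fin n) k) i) ∘ₗ s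
        - actX k M i ∘ₗ q.2
      map_add' := by
        intro p q; funext i; apply LinearMap.ext; intro m; simp; abel
      map_smul' := by
        intro c q; funext i; apply LinearMap.ext; intro m; simp [smul_sub] }
  have hDm : ∀ q i m, Dm q i m = E q ((X i : MvPolynomial (Fin n) k) • s m)
      - (X i : MvPolynomial (Fin n) k) • q.2 m := fun q i m => rfl
  have hEX : ∀ q (i : Fin n) f, E q ((X i : MvPolynomial (Fin n) k) • f)
      = (X i : MvPolynomial (Fin n) k) • E q f + Dm q i (φ f) := by
    intro q i f
    have h1 : E q ((X i : MvPolynomial (Fin n) k) • f)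
        = E q (((X i : MvPolynomial (Fin n) k) • π f : LinearMap.ker φ))
          + E q ((X i : MvPolynomial (Fin n) k) • s (φ f)) := by
      rw [← map_add]
      congr 1
      conv_lhs => rw [hdec f]
      rw [smul_add]; rfl
    rw [h1, hEK, map_smul, hDm, hE q f, smul_add]
    abel
  have hDZ : ∀ q, Dm q ∈ defZ k M := by
    intro q i j m
    have h1 := hEX q i ((X j : MvPolynomial (Fin n) k) • s m)
    have h2 := hEX q j ((X i : MvPolynomial (Fin n) k) • s m)
    rw [smul_smul, mul_comm, ← smul_smul, h2, hEX, hEX] at h1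
    simp only [map_smul, hs', smul_add, smul_smul] at h1
    simp only [actX_apply]
    rw [mul_comm (X j : MvPolynomial (Fin n) k) (X i), add_assoc, add_assoc] at h1
    exact (add_left_cancel h1).symm
  let T : ((↥(LinearMap.ker φ) →ₗ[MvPolynomial (Fin n) k] M) × (M →ₗ[k] M)) →ₗ[k]
      (defZ (n := n) k M) × (Fin r → M) :=
    LinearMap.prod (Dm.codRestrict _ hDZ)
      (LinearMap.pi fun j => LinearMap.applyₗ (Pi.single j 1) ∘ₗ E)
  have hT1 : ∀ q, ((T q).1 : Fin n → (M →ₗ[k] M)) = Dm q := fun q => rfl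
  have hT2 : ∀ q j, (T q).2 j = E q (Pi.single j 1) := fun q j => rfl
  refine ⟨LinearEquiv.ofBijective T ⟨?_, ?_⟩⟩
  · rw [← LinearMap.ker_eq_bot, LinearMap.ker_eq_bot']
    intro q hq
    have hD0 : Dm q = 0 := by rw [← hT1, hq]; rfl
    have hE0 : E q = 0 := by
      apply pi_psi_zero
      · intro i f; rw [hEX, hD0]; simp
      · intro j; rw [← hT2, hq]; rfl
    refine Prod.ext ?_ ?_
    · apply LinearMap.ext; intro f; rw [← hEK, hE0]; rfl
    · apply LinearMap.ext; intro f; rw [← hEs, hE0]; rfl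
  · rintro ⟨⟨D, hD⟩, v⟩
    obtain ⟨ψ, h1, h2⟩ := exists_psi φ D hD v
    let g : ↥(LinearMap.ker φ) →ₗ[k] M := ψ ∘ₗ ((LinearMap.ker φ).subtype.restrictScalars k)
    have hg : ∀ (p : MvPolynomial (Fin n) k) f, g (p • f) = p • g f := by
      apply map_smul_of_X
      intro i f
      change ψ ((X i : MvPolynomial (Fin n) k) • (f : Fin r → MvPolynomial (Fin n) k)) = _
      rw [h1, LinearMap.mem_ker.mp f.2]; simp [g]
    let q : ((↥(LinearMap.ker φ) →ₗ[MvPolynomial (Fin n) k] M) × (M →ₗ[k] M)) :=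
      ({ toFun := g, map_add' := g.map_add, map_smul' := hg }, ψ ∘ₗ s)
    have hq : E q = ψ := by
      apply LinearMap.ext; intro f
      rw [hE]
      conv_rhs => rw [hdec f]
      rw [map_add]; rfl
    refine ⟨q, Prod.ext (Subtype.ext ?_) ?_⟩
    · rw [hT1]
      funext i; apply LinearMap.ext; intro m
      rw [hDm, hq, h1, hs']
      simp [q]
    · funext j; rw [hT2, hq, h2]

lemma finrank_hom_ker (hM : Module.finrank k M = 2)
    (φ : (Fin r → MvPolynomial (Fin n) k) →ₗ[MvPolynomial (Fin n) k] M)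
    (hφ : Function.Surjective φ) :
    Module.finrank k (↥(LinearMap.ker φ) →ₗ[MvPolynomial (Fin n) k] M) + 4
      = Module.finrank k (defZ (n := n) k M) + 2 * r := by
  haveI : Module.Finite k M := Module.finite_of_finrank_pos (by omega)
  obtain ⟨e⟩ := hom_ker_equiv φ hφ
  haveI : Module.Finite k ((↥(LinearMap.ker φ) →ₗ[MvPolynomial (Fin n) k] M) × (M →ₗ[k] M)) :=
    Module.Finite.equiv e.symm
  haveI : Module.Finite k (↥(LinearMap.ker φ) →ₗ[MvPolynomial (Fin n) k] M) :=
    Module.Finite.of_surjective (LinearMap.fst k _ (M →ₗ[k] M)) LinearMap.fst_surjective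
  have := e.finrank_eq
  rw [Module.finrank_prod, Module.finrank_prod, Module.finrank_linearMap k k M M, hM,
    Module.finrank_pi_fintype] at this
  simp [hM] at this
  omega

lemma finrank_defZ_scalar (hM : Module.finrank k M = 2)
    (h : ∀ i : Fin n, ∃ c : k, ∀ m : M, (X i : MvPolynomial (Fin n) k) • m = c • m) :
    Module.finrank k (defZ (n := n) k M) = 4 * n := by
  haveI : Module.Finite k M := Module.finite_of_finrank_pos (by omega)
  have : defZ (n := n) k M = ⊤ := by
    rw [eq_top_iff]
    intro D _ i j m
    obtain ⟨c, hc⟩ := h i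
    obtain ⟨d, hd⟩ := h j
    simp only [actX_apply, hc, hd, map_smul]
    abel
  rw [this, finrank_top, Module.finrank_pi_fintype]
  simp [Module.finrank_linearMap, hM]
  ring

lemma finrank_defZ_nonscalar (hM : Module.finrank k M = 2) (i₀ : Fin n)
    (h : ¬ ∃ c : k, ∀ m : M, (X i₀ : MvPolynomial (Fin n) k) • m = c • m) :
    Module.finrank k (defZ (n := n) k M) = 2 * n + 2 := by
  haveI : Module.Finite k M := Module.finite_of_finrank_pos (by omega)
  set x := actX k M i₀ with hx
  obtain ⟨m₀, hm₀⟩ : ∃ m, LinearIndependent k ![m, x m] := by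
    by_contra! hcon
    obtain ⟨c, hc⟩ := LinearMap.exists_eq_smul_id_of_forall_notLinearIndependent hcon
    exact h ⟨c, fun m => by rw [← actX_apply, ← hx, hc]; rfl⟩
  have hspan : ∀ m, ∃ a b : k, m = a • m₀ + b • x m₀ := by
    intro m
    have h1 := hm₀.span_eq_top_of_card_eq_finrank' (by simp [hM])
    have h2 : m ∈ Submodule.span k (Set.range ![m₀, x m₀]) := by rw [h1]; trivial
    simp only [Matrix.range_cons, Matrix.range_empty, Set.union_empty,
      Set.singleton_union] at h2
    obtain ⟨a, b, hab⟩ := Submodule.mem_span_pair.mp h2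
    exact ⟨a, b, hab.symm⟩
  have hcent : ∀ y : M →ₗ[k] M, (∀ m, x (y m) = y (x m)) →
      ∃ a b : k, ∀ m, y m = a • m + b • x m := by
    intro y hy
    obtain ⟨a, b, hab⟩ := hspan (y m₀)
    refine ⟨a, b, fun m => ?_⟩
    obtain ⟨c, d, rfl⟩ := hspan m
    rw [map_add, map_smul, map_smul, ← hy, hab]
    simp only [map_add, map_smul]
    module
  have hX : ∀ i : Fin n, ∃ a b : k, ∀ m : M, actX k M i m = a • m + b • x m := by
    intro i
    exact hcent _ fun m => actX_comm i₀ i m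
  choose a b hab using hX
  let P : ((M →ₗ[k] M) × ({i : Fin n // i ≠ i₀} → k × k)) →ₗ[k] (Fin n → (M →ₗ[k] M)) :=
    { toFun := fun q i => if hi : i = i₀ then q.1 else
        b i • q.1 + (q.2 ⟨i, hi⟩).1 • LinearMap.id + (q.2 ⟨i, hi⟩).2 • x
      map_add' := by
        intro p q; funext i
        by_cases hi : i = i₀
        · simp [hi]
        · simp only [hi, dif_neg, not_false_eq_true, Prod.fst_add, Prod.snd_add, Pi.add_apply]
          module
      map_smul' := by
        intro c q; funext i
        by_cases hi : i = i₀
        · simp [hi]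
        · simp only [hi, dif_neg, not_false_eq_true, Prod.smul_fst, Prod.smul_snd, Pi.smul_apply,
            RingHom.id_apply, smul_eq_mul]
          module }
  have hP0 : ∀ q, P q i₀ = q.1 := by intro q; simp [P]
  have hP1 : ∀ q i (hi : i ≠ i₀) m, P q i m
      = b i • q.1 m + (q.2 ⟨i, hi⟩).1 • m + (q.2 ⟨i, hi⟩).2 • x m := by
    intro q i hi m; simp [P, hi]
  -- uniform description
  have hb0 : ∀ m, a i₀ • m + b i₀ • x m = x m := fun m => (hab i₀ m).symm
  have hli : ∀ c d : k, c • m₀ + d • x m₀ = 0 → c = 0 ∧ d = 0 := by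
    intro c d hcd
    exact LinearIndependent.pair_iff.mp hm₀ c d hcd
  have hbi : b i₀ = 1 := by
    have := (hli (a i₀) (b i₀ - 1) (by
      have := hb0 m₀
      rw [sub_smul, one_smul, ← add_sub_assoc, this, sub_self])).2
    exact sub_eq_zero.mp this
  have hPu : ∀ q i, ∃ c d : k, ∀ m, P q i m = b i • q.1 m + c • m + d • x m := by
    intro q i
    by_cases hi : i = i₀
    · subst hi
      exact ⟨0, 0, fun m => by rw [hP0, hbi]; simp⟩
    · exact ⟨_, _, hP1 q i hi⟩
  have hPZ : ∀ q, P q ∈ defZ k M := by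
    intro q i j m
    obtain ⟨c, d, hcd⟩ := hPu q i
    obtain ⟨c', d', hcd'⟩ := hPu q j
    simp only [hcd, hcd', hab, map_add, map_smul]
    module
  let T := P.codRestrict _ hPZ
  have hT : ∀ q, (T q : Fin n → (M →ₗ[k] M)) = P q := fun q => rfl
  have hbij : Function.Bijective T := by
    constructor
    · rw [← LinearMap.ker_eq_bot, LinearMap.ker_eq_bot']
      intro q hq
      have hq' : P q = 0 := by rw [← hT, hq]; rfl
      have h1 : q.1 = 0 := by rw [← hP0, hq']; rfl
      refine Prod.ext h1 ?_
      funext i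
      have h2 := hP1 q i.1 i.2 m₀
      rw [hq', h1] at h2
      simp only [Pi.zero_apply, LinearMap.zero_apply, smul_zero, zero_add] at h2
      have h3 := hli _ _ h2.symm
      exact Prod.ext h3.1 h3.2
    · rintro ⟨D, hD⟩
      have hex : ∀ i, ∃ c d : k, ∀ m, (D i - b i • D i₀) m = c • m + d • x m := by
        intro i
        apply hcent
        intro m
        have h1 := hD i₀ i m
        rw [← hx] at h1
        simp only [hab i, map_add, map_smul] at h1
        simp only [LinearMap.sub_apply, LinearMap.smul_apply, map_sub, map_smul]
        rw [sub_eq_sub_iff_add_eq_add]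
        have h2 : x (D i m) + b i • D i₀ (x m) = b i • x (D i₀ m) + D i (x m) := by
          have := congrArg (fun t => t - a i • D i₀ m) h1
          calc _ = x (D i m) + (a i • D i₀ m + b i • D i₀ (x m)) - a i • D i₀ m := by abel
            _ = _ := this
            _ = _ := by abel
        rw [h2]; abel
      choose c d hcd using hex
      refine ⟨(D i₀, fun i => (c i, d i)), Subtype.ext ?_⟩
      rw [hT]
      funext i
      by_cases hi : i = i₀
      · subst hi; rw [hP0]
      · apply LinearMap.ext; intro m
        rw [hP1 _ _ hi, add_assoc]
        simp only
        rw [← hcd]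
        simp
  have := (LinearEquiv.ofBijective T hbij).finrank_eq
  rw [← this, Module.finrank_prod, Module.finrank_linearMap, hM, Module.finrank_pi_fintype]
  have hpos : 0 < n := i₀.pos
  simp [Module.finrank_prod, Fintype.card_subtype_compl]
  omega

end HomKerAux


theorem hom_ker_dim_quot_two
    {k : Type*} [Field k] [IsAlgClosed k] [CharZero k]
    (n r : ℕ) (hn : 2 ≤ n) (hr : 1 ≤ r)
    {M : Type*} [AddCommGroup M] [Module k M]
    [Module (MvPolynomial (Fin n) k) M]
    [IsScalarTower k (MvPolynomial (Fin n) k) M]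
    (hM : Module.finrank k M = 2)
    (φ : (Fin r → MvPolynomial (Fin n) k) →ₗ[MvPolynomial (Fin n) k] M)
    (hφ : Function.Surjective φ) :
    ((∃ i : Fin n, ¬ ∃ c : k, ∀ m : M, (MvPolynomial.X i : MvPolynomial (Fin n) k) • m = c • m) →
      Module.finrank k
        (↥(LinearMap.ker φ) →ₗ[MvPolynomial (Fin n) k] M) = 2 * n + 2 * r - 2) ∧
    ((∀ i : Fin n, ∃ c : k, ∀ m : M, (MvPolynomial.X i : MvPolynomial (Fin n) k) • m = c • m) →
      2 * n + 2 * r - 2 <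
        Module.finrank k
          (↥(LinearMap.ker φ) →ₗ[MvPolynomial (Fin n) k] M)) := by
  refine ⟨?_, ?_⟩
  · rintro ⟨i, hi⟩
    have h1 := finrank_hom_ker hM φ hφ
    have h2 := finrank_defZ_nonscalar hM i hi
    omega
  · intro h
    have h1 := finrank_hom_ker hM φ hφ
    have h2 := finrank_defZ_scalar hM h
    omega
end
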